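/- Let q belong to the Schwartz space 𝒮(ℝ;ℂ) and let λ ∈ ℂ satisfy Im(λ²) > 0. Define s₂(λ) = −λ²·I_λ({x₁<y₁}), s₄(λ) = λ⁴·I_λ({x₁<y₁<x₂<y₂}), and b₄(λ) = s₄(λ) − s₂(λ)²/2. Then b₄(λ) = (i/(2π)) ∫_{ℝ³} ( λ⁴ / ( (2λ²+ξ₁)(2λ²+η₁)(2λ²+η₂) ) ) · Re( q̂(η₁)·q̂(η₂)·conj(q̂(ξ₁))·conj(q̂(η₁+η₂−ξ₁)) ) dξ₁ dη₁ dη₂. -/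

import Mathlib

open MeasureTheory

/-- The elementary kernel `q(y)·conj(q(x))·exp(2iλ²(y−x))`. -/
noncomputable def ker (q : ℝ → ℂ) (lam : ℂ) (x y : ℝ) : ℂ :=
  q y * (starRingEnd ℂ) (q x) * Complex.exp (2 * Complex.I * lam ^ 2 * ((y - x : ℝ) : ℂ))

/-- Integrand on `ℝ²`, in the variables `p = (x₁, y₁)`. -/
noncomputable def f2 (q : ℝ → ℂ) (lam : ℂ) (p : ℝ × ℝ) : ℂ :=
  ker q lam p.1 p.2

/-- Integrand on `ℝ⁴`, in the variables `p = (x₁, y₁, x₂, y₂)`. -/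
noncomputable def f4 (q : ℝ → ℂ) (lam : ℂ) (p : ℝ × ℝ × ℝ × ℝ) : ℂ :=
  ker q lam p.1 p.2.1 * ker q lam p.2.2.1 p.2.2.2

/-- Integrand on `ℝ⁶`, in the variables `p = (x₁, y₁, x₂, y₂, x₃, y₃)`. -/
noncomputable def f6 (q : ℝ → ℂ) (lam : ℂ) (p : ℝ × ℝ × ℝ × ℝ × ℝ × ℝ) : ℂ :=
  ker q lam p.1 p.2.1 * ker q lam p.2.2.1 p.2.2.2.1 * ker q lam p.2.2.2.2.1 p.2.2.2.2.2

/-- The region `{x₁ < y₁}` of `ℝ²`, in the variables `p = (x₁, y₁)`. -/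
def R_XY : Set (ℝ × ℝ) := {p | p.1 < p.2}

/-- The region `{x₁ < y₁ < x₂ < y₂}` of `ℝ⁴`, in the variables `p = (x₁, y₁, x₂, y₂)`. -/
def R_XYXY : Set (ℝ × ℝ × ℝ × ℝ) :=
  {p | p.1 < p.2.1 ∧ p.2.1 < p.2.2.1 ∧ p.2.2.1 < p.2.2.2}

/-- The region `{x₁ < x₂ < y₁ < y₂}` of `ℝ⁴`, in the variables `p = (x₁, y₁, x₂, y₂)`. -/
def R_XXYY : Set (ℝ × ℝ × ℝ × ℝ) :=
  {p | p.1 < p.2.2.1 ∧ p.2.2.1 < p.2.1 ∧ p.2.1 < p.2.2.2}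

/-- The region `{x₁ < y₁ < x₂ < y₂ < x₃ < y₃}` of `ℝ⁶`,
in the variables `p = (x₁, y₁, x₂, y₂, x₃, y₃)`. -/
def R_XYXYXY : Set (ℝ × ℝ × ℝ × ℝ × ℝ × ℝ) :=
  {p | p.1 < p.2.1 ∧ p.2.1 < p.2.2.1 ∧ p.2.2.1 < p.2.2.2.1 ∧
       p.2.2.2.1 < p.2.2.2.2.1 ∧ p.2.2.2.2.1 < p.2.2.2.2.2}

/-- The region `{x₁ < x₂ < y₁ < y₂ < x₃ < y₃}` of `ℝ⁶`,
in the variables `p = (x₁, y₁, x₂, y₂, x₃, y₃)`. -/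
def R_XXYYXY : Set (ℝ × ℝ × ℝ × ℝ × ℝ × ℝ) :=
  {p | p.1 < p.2.2.1 ∧ p.2.2.1 < p.2.1 ∧ p.2.1 < p.2.2.2.1 ∧
       p.2.2.2.1 < p.2.2.2.2.1 ∧ p.2.2.2.2.1 < p.2.2.2.2.2}

/-- The region `{x₁ < x₂ < y₁ < x₃ < y₂ < y₃}` of `ℝ⁶`,
in the variables `p = (x₁, y₁, x₂, y₂, x₃, y₃)`. -/
def R_XXYXYY : Set (ℝ × ℝ × ℝ × ℝ × ℝ × ℝ) :=
  {p | p.1 < p.2.2.1 ∧ p.2.2.1 < p.2.1 ∧ p.2.1 < p.2.2.2.2.1 ∧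
       p.2.2.2.2.1 < p.2.2.2.1 ∧ p.2.2.2.1 < p.2.2.2.2.2}

/-- The region `{x₁ < y₁ < x₂ < x₃ < y₂ < y₃}` of `ℝ⁶`,
in the variables `p = (x₁, y₁, x₂, y₂, x₃, y₃)`. -/
def R_XYXXYY : Set (ℝ × ℝ × ℝ × ℝ × ℝ × ℝ) :=
  {p | p.1 < p.2.1 ∧ p.2.1 < p.2.2.1 ∧ p.2.2.1 < p.2.2.2.2.1 ∧
       p.2.2.2.2.1 < p.2.2.2.1 ∧ p.2.2.2.1 < p.2.2.2.2.2}

/-- The region `{x₁ < x₂ < x₃ < y₁ < y₂ < y₃}` of `ℝ⁶`,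
in the variables `p = (x₁, y₁, x₂, y₂, x₃, y₃)`. -/
def R_XXXYYY : Set (ℝ × ℝ × ℝ × ℝ × ℝ × ℝ) :=
  {p | p.1 < p.2.2.1 ∧ p.2.2.1 < p.2.2.2.2.1 ∧ p.2.2.2.2.1 < p.2.1 ∧
       p.2.1 < p.2.2.2.1 ∧ p.2.2.2.1 < p.2.2.2.2.2}

/-- The unitary Fourier transform `q̂(ξ) = (2π)^{−1/2} ∫ q(x) e^{−ixξ} dx`. -/
noncomputable def ft (q : ℝ → ℂ) (ξ : ℝ) : ℂ :=
  ((Real.sqrt (2 * Real.pi) : ℝ) : ℂ)⁻¹ * ∫ x : ℝ, q x * Complex.exp (-Complex.I * x * ξ)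

open Complex Set Topology ComplexConjugate FourierTransform
open Filter hiding ker

theorem norm_cexp_I_mul_mul (η x : ℝ) : ‖cexp (I * η * x)‖ = 1 := by
  rw [show I * (η : ℂ) * x = ((η * x : ℝ) : ℂ) * I by push_cast; ring, norm_exp_ofReal_mul_I]

theorem im_le_norm_add_ofReal (a : ℂ) (η : ℝ) : a.im ≤ ‖a + η‖ := by
  simpa using im_le_norm (a + η)

theorem add_ofReal_ne_zero {a : ℂ} (ha : 0 < a.im) (η : ℝ) : a + η ≠ 0 :=
  norm_pos_iff.1 (ha.trans_le (im_le_norm_add_ofReal a η))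

theorem integrable_mul_I_div_add {a : ℂ} (ha : 0 < a.im) {h : ℝ → ℂ} (hh : Integrable h) :
    Integrable fun η : ℝ ↦ h η * (I / (a + η)) := by
  refine hh.mul_bdd (c := a.im⁻¹) (Measurable.aestronglyMeasurable (by fun_prop))
    (ae_of_all _ fun η ↦ ?_)
  rw [norm_div, norm_I, one_div]
  exact inv_anti₀ ha (im_le_norm_add_ofReal a η)

theorem integrable_mul_cexp {h : ℝ → ℂ} (hh : Integrable h) (x : ℝ) :
    Integrable fun η : ℝ ↦ h η * cexp (I * η * x) :=
  hh.mul_bdd (c := 1) (by fun_prop) (ae_of_all _ fun η ↦ (norm_cexp_I_mul_mul η x).le)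

theorem hasDerivAt_integral_Ioi {g : ℝ → ℂ} (hc : Continuous g) (hg : Integrable g) (x : ℝ) :
    HasDerivAt (fun x ↦ ∫ t in Ioi x, g t) (-g x) x := by
  have key : (fun x ↦ ∫ t in Ioi x, g t)
      = fun x ↦ (∫ t in Ioi 0, g t) - ∫ t in (0 : ℝ)..x, g t := by
    ext x
    rw [← intervalIntegral.integral_interval_add_Ioi (hg.integrableOn (s := Ioi 0))
      (hg.integrableOn (s := Ioi x))]
    ring
  rw [key]
  exact (intervalIntegral.integral_hasDerivAt_right (hc.intervalIntegrable _ _)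
    (hc.stronglyMeasurableAtFilter _ _) hc.continuousAt).const_sub _

theorem tendsto_integral_mul_cexp_cocompact (h : ℝ → ℂ) :
    Tendsto (fun x : ℝ ↦ ∫ η : ℝ, h η * cexp (I * η * x)) (cocompact ℝ) (𝓝 0) := by
  have hlim : Tendsto (fun x : ℝ ↦ -(2 * Real.pi)⁻¹ * x) (cocompact ℝ) (cocompact ℝ) :=
    (Homeomorph.mulLeft₀ (-(2 * Real.pi)⁻¹)
      (by simp [Real.pi_ne_zero])).isClosedEmbedding.tendsto_cocompact
  refine ((Real.tendsto_integral_exp_smul_cocompact h).comp hlim).congr fun x ↦ ?_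
  refine integral_congr_ae (ae_of_all _ fun η ↦ ?_)
  simp only [Circle.smul_def, Real.fourierChar_apply, smul_eq_mul]
  rw [mul_comm]
  congr 2
  push_cast
  have := ofReal_ne_zero.2 Real.pi_ne_zero
  field_simp

/-- The half-line integral `∫_{s > 0} q(x + s) e^{ias} ds`. -/
noncomputable def tailInt (a : ℂ) (q : ℝ → ℂ) (x : ℝ) : ℂ :=
  ∫ s in Ioi (0 : ℝ), q (x + s) * cexp (I * a * s)

/-- The involution `q ↦ conj (q (-·))`. -/
def conjReflect (q : ℝ → ℂ) (x : ℝ) : ℂ := conj (q (-x))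

theorem conjReflect_conjReflect (q : ℝ → ℂ) : conjReflect (conjReflect q) = q := by
  ext x; simp [conjReflect]

section tailInt

variable {a : ℂ} {q h : ℝ → ℂ}

theorem tailInt_eq_integral (ha : 0 < a.im) (hh : Integrable h)
    (hq : ∀ x : ℝ, q x = ∫ η : ℝ, h η * cexp (I * η * x)) (x : ℝ) :
    tailInt a q x = ∫ η : ℝ, h η * (I / (a + η)) * cexp (I * η * x) := by
  have hre : (I * a).re < 0 := by simpa using ha
  have hFint : Integrable (Function.uncurry fun s η : ℝ ↦
      cexp (I * a * s) * h η * cexp (I * η * (x + s : ℝ)))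
      ((volume.restrict (Ioi 0)).prod volume) := by
    refine Integrable.mul_bdd (c := 1)
      (Integrable.mul_prod (integrableOn_exp_mul_complex_Ioi hre 0) hh) ?_
      (ae_of_all _ fun p ↦ (norm_cexp_I_mul_mul _ _).le)
    exact Continuous.aestronglyMeasurable (by fun_prop)
  calc tailInt a q x
      = ∫ s in Ioi (0 : ℝ), ∫ η : ℝ, cexp (I * a * s) * h η * cexp (I * η * (x + s : ℝ)) := by
        refine integral_congr_ae (ae_of_all _ fun s ↦ ?_)
        simp only [hq, ← integral_mul_const]
        exact integral_congr_ae (ae_of_all _ fun η ↦ by ring)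
    _ = ∫ η : ℝ, ∫ s in Ioi (0 : ℝ), cexp (I * a * s) * h η * cexp (I * η * (x + s : ℝ)) :=
        integral_integral_swap hFint
    _ = _ := by
        refine integral_congr_ae (ae_of_all _ fun η ↦ ?_)
        have hne := add_ofReal_ne_zero ha η
        have hre' : (I * (a + η)).re < 0 := by simpa using ha
        have hs : ∀ s : ℝ, cexp (I * a * s) * h η * cexp (I * η * (x + s : ℝ))
            = h η * cexp (I * η * x) * cexp (I * (a + η) * s) := fun s ↦ by
          rw [show I * (η : ℂ) * (x + s : ℝ) = I * η * x + I * η * s by push_cast; ring,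
            show I * (a + η) * s = I * a * s + I * η * s by ring, Complex.exp_add,
            Complex.exp_add]
          ring
        simp only [hs]
        rw [integral_const_mul, integral_exp_mul_complex_Ioi hre']
        simp only [ofReal_zero, mul_zero, Complex.exp_zero]
        rw [show -1 / (I * (a + η)) = I / (a + η) by
          field_simp; simp]
        ring

theorem hasDerivAt_tailInt (ha : 0 < a.im) (hh : Integrable h)
    (hq : ∀ x : ℝ, q x = ∫ η : ℝ, h η * cexp (I * η * x)) (x : ℝ) :
    HasDerivAt (tailInt a q) (-q x - I * a * tailInt a q x) x := by
  have hw := integrable_mul_I_div_add ha hh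
  rw [funext (tailInt_eq_integral ha hh hq)]
  have hid : ∀ η y : ℝ, h η * (I / (a + η)) * (I * η * cexp (I * η * y))
      = -(h η * cexp (I * η * y)) - I * a * (h η * (I / (a + η)) * cexp (I * η * y)) := by
    intro η y
    have hne := add_ofReal_ne_zero ha η
    field_simp
    linear_combination (h η * (a + η)) * I_sq
  have hder := hasDerivAt_integral_of_dominated_loc_of_deriv_le (𝕜 := ℝ) (μ := volume)
    (F := fun y η : ℝ ↦ h η * (I / (a + η)) * cexp (I * η * y))
    (F' := fun y η : ℝ ↦ h η * (I / (a + η)) * (I * η * cexp (I * η * y)))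
    (bound := fun η ↦ ‖h η‖ + ‖I * a‖ * ‖h η * (I / (a + η))‖) (x₀ := x) (s := univ)
    univ_mem (Eventually.of_forall fun y ↦ (integrable_mul_cexp hw y).aestronglyMeasurable)
    (integrable_mul_cexp hw x) (hw.aestronglyMeasurable.mul (by fun_prop))
    (ae_of_all _ fun η y _ ↦ by
      rw [hid]
      refine (norm_sub_le _ _).trans_eq ?_
      rw [norm_neg, norm_mul, norm_mul (I * a), norm_mul (h η * _), norm_cexp_I_mul_mul]
      simp only [mul_one])
    (hh.norm.add (hw.norm.const_mul _))
    (ae_of_all _ fun η y _ ↦ by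
      refine HasDerivAt.const_mul _ ?_
      have := ((hasDerivAt_id y).ofReal_comp.const_mul (I * (η : ℂ))).cexp
      simpa [mul_comm] using this)
  refine hder.2.congr_deriv ?_
  simp only [hid]
  rw [hq, ← integral_neg, ← integral_const_mul]
  exact integral_sub (integrable_mul_cexp hh x).neg ((integrable_mul_cexp hw x).const_mul _)

theorem tendsto_tailInt_cocompact (ha : 0 < a.im) (hh : Integrable h)
    (hq : ∀ x : ℝ, q x = ∫ η : ℝ, h η * cexp (I * η * x)) :
    Tendsto (tailInt a q) (cocompact ℝ) (𝓝 0) := by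
  rw [funext (tailInt_eq_integral ha hh hq)]
  exact tendsto_integral_mul_cexp_cocompact _

theorem exists_norm_tailInt_le (ha : 0 < a.im) (hh : Integrable h)
    (hq : ∀ x : ℝ, q x = ∫ η : ℝ, h η * cexp (I * η * x)) :
    ∃ C, ∀ x, ‖tailInt a q x‖ ≤ C := by
  refine ⟨∫ η : ℝ, ‖h η * (I / (a + η))‖, fun x ↦ ?_⟩
  rw [tailInt_eq_integral ha hh hq]
  refine (norm_integral_le_integral_norm _).trans_eq ?_
  refine integral_congr_ae (ae_of_all _ fun η ↦ ?_)
  simp only [norm_mul _ (cexp _), norm_cexp_I_mul_mul, mul_one]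

end tailInt

section region

variable {α β : Type*} [MeasurableSpace α] [MeasurableSpace β] {μ : Measure α} {ν : Measure β}
  [SFinite μ] [SFinite ν]

theorem setIntegral_eq_integral_setIntegral_slice {S : Set (α × β)} (hS : MeasurableSet S)
    {F : α × β → ℂ} (hF : IntegrableOn F S (μ.prod ν)) :
    ∫ z in S, F z ∂μ.prod ν = ∫ x, ∫ y in {y | (x, y) ∈ S}, F (x, y) ∂ν ∂μ := by
  rw [← integral_indicator hS, integral_prod _ ((integrable_indicator_iff hS).2 hF)]
  refine integral_congr_ae (ae_of_all _ fun x ↦ ?_)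
  exact integral_indicator (f := fun y ↦ F (x, y)) (measurable_prodMk_left hS)

theorem setIntegral_eq_integral_setIntegral_slice_symm {S : Set (α × β)} (hS : MeasurableSet S)
    {F : α × β → ℂ} (hF : IntegrableOn F S (μ.prod ν)) :
    ∫ z in S, F z ∂μ.prod ν = ∫ y, ∫ x in {x | (x, y) ∈ S}, F (x, y) ∂μ ∂ν := by
  rw [← integral_indicator hS, integral_prod_symm _ ((integrable_indicator_iff hS).2 hF)]
  refine integral_congr_ae (ae_of_all _ fun y ↦ ?_)
  exact integral_indicator (f := fun x ↦ F (x, y)) (measurable_prodMk_right hS)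

end region

section ker

variable {q : ℝ → ℂ} {lam : ℂ}

theorem norm_ker_le (hlam : 0 < (lam ^ 2).im) {x y : ℝ} (hxy : x ≤ y) :
    ‖ker q lam x y‖ ≤ ‖q x‖ * ‖q y‖ := by
  have hexp : ‖cexp (2 * I * lam ^ 2 * ((y - x : ℝ) : ℂ))‖ ≤ 1 := by
    rw [norm_exp, Real.exp_le_one_iff, re_mul_ofReal]
    refine mul_nonpos_of_nonpos_of_nonneg ?_ (sub_nonneg.2 hxy)
    rw [mul_assoc, ← ofReal_ofNat, re_ofReal_mul, I_mul_re]
    linarith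
  rw [ker, norm_mul, norm_mul, norm_conj, mul_comm ‖q y‖]
  exact mul_le_of_le_one_right (by positivity) hexp

theorem integral_Ioi_ker (x : ℝ) :
    ∫ y in Ioi x, ker q lam x y = conj (q x) * tailInt (2 * lam ^ 2) q x := by
  rw [tailInt, ← integral_const_mul, ← integral_indicator measurableSet_Ioi,
    ← integral_indicator measurableSet_Ioi, ← integral_add_left_eq_self _ x]
  refine integral_congr_ae (ae_of_all _ fun s ↦ ?_)
  simp only [indicator, mem_Ioi, lt_add_iff_pos_right, ker, add_sub_cancel_left]
  split_ifs
  · ring_nf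
  · rfl

theorem integral_Iio_ker (y : ℝ) :
    ∫ x in Iio y, ker q lam x y = q y * tailInt (2 * lam ^ 2) (conjReflect q) (-y) := by
  rw [tailInt, ← integral_const_mul, ← integral_indicator measurableSet_Iio,
    ← integral_indicator measurableSet_Ioi, ← integral_sub_left_eq_self _ _ y]
  refine integral_congr_ae (ae_of_all _ fun s ↦ ?_)
  simp only [indicator, mem_Iio, mem_Ioi, sub_lt_self_iff, ker, sub_sub_cancel, conjReflect]
  split_ifs
  · ring_nf
  · rfl

theorem measurableSet_R_XY : MeasurableSet R_XY :=
  measurableSet_lt measurable_fst measurable_snd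

theorem measurableSet_R_XYXY : MeasurableSet R_XYXY := by
  unfold R_XYXY
  measurability

theorem integrableOn_ker (hlam : 0 < (lam ^ 2).im) (hc : Continuous q) (hi : Integrable q) :
    IntegrableOn (fun z : ℝ × ℝ ↦ ker q lam z.1 z.2) R_XY := by
  refine Integrable.mono' (hi.norm.mul_prod hi.norm).integrableOn ?_ ?_
  · unfold ker
    exact Continuous.aestronglyMeasurable (by fun_prop)
  · exact (ae_restrict_mem measurableSet_R_XY).mono fun z hz ↦ norm_ker_le hlam (le_of_lt hz)

theorem setIntegral_R_XY_ker (hlam : 0 < (lam ^ 2).im) (hc : Continuous q) (hi : Integrable q) :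
    ∫ z in R_XY, f2 q lam z = ∫ x, conj (q x) * tailInt (2 * lam ^ 2) q x := by
  refine (setIntegral_eq_integral_setIntegral_slice measurableSet_R_XY
    (integrableOn_ker hlam hc hi)).trans ?_
  exact integral_congr_ae (ae_of_all _ fun x ↦ integral_Ioi_ker x)

theorem setIntegral_R_XY_ker_mul (hlam : 0 < (lam ^ 2).im) (hc : Continuous q)
    (hi : Integrable q) {φ : ℝ → ℂ} (hφ : Continuous φ) {C : ℝ} (hC : ∀ y, ‖φ y‖ ≤ C) :
    ∫ z in R_XY, ker q lam z.1 z.2 * φ z.2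
      = ∫ y, q y * tailInt (2 * lam ^ 2) (conjReflect q) (-y) * φ y := by
  refine (setIntegral_eq_integral_setIntegral_slice_symm measurableSet_R_XY
    ((integrableOn_ker hlam hc hi).mul_bdd (g := fun z : ℝ × ℝ ↦ φ z.2)
      (Continuous.aestronglyMeasurable (by fun_prop)) (ae_of_all _ fun z ↦ hC z.2))).trans ?_
  refine integral_congr_ae (ae_of_all _ fun y ↦ ?_)
  exact (integral_mul_const _ _).trans (congrArg (· * φ y) (integral_Iio_ker y))

theorem setIntegral_lt_ker (hlam : 0 < (lam ^ 2).im) (hc : Continuous q) (hi : Integrable q)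
    (t : ℝ) :
    ∫ z in {z : ℝ × ℝ | t < z.1 ∧ z.1 < z.2}, ker q lam z.1 z.2
      = ∫ x in Ioi t, conj (q x) * tailInt (2 * lam ^ 2) q x := by
  have hm : MeasurableSet {z : ℝ × ℝ | t < z.1 ∧ z.1 < z.2} := by measurability
  refine (setIntegral_eq_integral_setIntegral_slice hm
    ((integrableOn_ker hlam hc hi).mono_set fun z hz ↦ hz.2)).trans ?_
  rw [← integral_indicator measurableSet_Ioi]
  refine integral_congr_ae (ae_of_all _ fun x ↦ ?_)
  by_cases hx : t < x
  · simp only [mem_ofPred_eq, hx, true_and, indicator_of_mem (mem_Ioi.2 hx)]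
    exact integral_Ioi_ker x
  · simp [hx]

theorem setIntegral_R_XYXY (hlam : 0 < (lam ^ 2).im) (hc : Continuous q) (hi : Integrable q) :
    ∫ p in R_XYXY, f4 q lam p
      = ∫ z in R_XY, ker q lam z.1 z.2 *
          ∫ x in Ioi z.2, conj (q x) * tailInt (2 * lam ^ 2) q x := by
  have hassoc : MeasurePreserving (MeasurableEquiv.prodAssoc : (ℝ × ℝ) × ℝ × ℝ ≃ᵐ ℝ × ℝ × ℝ × ℝ) :=
    volume_preserving_prodAssoc
  rw [← hassoc.setIntegral_preimage_emb MeasurableEquiv.prodAssoc.measurableEmbedding]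
  have hm : MeasurableSet ((MeasurableEquiv.prodAssoc : (ℝ × ℝ) × ℝ × ℝ ≃ᵐ _) ⁻¹' R_XYXY) :=
    MeasurableEquiv.prodAssoc.measurable measurableSet_R_XYXY
  have hFint : IntegrableOn (fun w : (ℝ × ℝ) × ℝ × ℝ ↦
      ker q lam w.1.1 w.1.2 * ker q lam w.2.1 w.2.2) (R_XY ×ˢ R_XY) := by
    rw [IntegrableOn, Measure.volume_eq_prod, ← Measure.prod_restrict]
    exact (integrableOn_ker hlam hc hi).mul_prod (integrableOn_ker hlam hc hi)
  refine (setIntegral_eq_integral_setIntegral_slice hm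
    (hFint.mono_set fun w hw ↦ ⟨hw.1, hw.2.2⟩)).trans ?_
  rw [← integral_indicator measurableSet_R_XY]
  refine integral_congr_ae (ae_of_all _ fun z ↦ ?_)
  by_cases hz : z ∈ R_XY
  · have hset : {y : ℝ × ℝ | (z, y) ∈ MeasurableEquiv.prodAssoc ⁻¹' R_XYXY}
        = {y : ℝ × ℝ | z.2 < y.1 ∧ y.1 < y.2} := by
      ext y
      exact and_iff_right hz
    simp only [indicator_of_mem hz]
    rw [hset, ← setIntegral_lt_ker hlam hc hi, ← integral_const_mul]
  · have hset : {y : ℝ × ℝ | (z, y) ∈ MeasurableEquiv.prodAssoc ⁻¹' R_XYXY} = ∅ := by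
      ext y
      exact iff_false_intro fun hy ↦ hz hy.1
    simp only [indicator_of_notMem hz]
    rw [hset, setIntegral_empty]

end ker

/-- If `W` is a primitive of `g - f` that vanishes at infinity, the iterated integral
of `f` against the tail of `g` differs from `(∫ g)² / 2` by the mean of `∫ g W` and `∫ f W`, up to sign. -/
theorem integral_mul_tail_sub_sq {f g W : ℝ → ℂ} (hg : Continuous g) (hfi : Integrable f)
    (hgi : Integrable g) (hW : ∀ x, HasDerivAt W (g x - f x) x)
    (hW0 : Tendsto W (cocompact ℝ) (𝓝 0)) {C : ℝ} (hC : ∀ x, ‖W x‖ ≤ C) :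
    (∫ x, f x * ∫ t in Ioi x, g t) - (∫ x, g x) ^ 2 / 2
      = -((∫ x, g x * W x) + ∫ x, f x * W x) / 2 := by
  set G : ℝ → ℂ := fun x ↦ ∫ t in Ioi x, g t with hG
  have hGd : ∀ x, HasDerivAt G (-g x) x := hasDerivAt_integral_Ioi hg hgi
  have hGc : Continuous G := continuous_iff_continuousAt.2 fun x ↦ (hGd x).continuousAt
  have hWc : Continuous W := continuous_iff_continuousAt.2 fun x ↦ (hW x).continuousAt
  have hGb : ∀ x, ‖G x‖ ≤ ∫ t, ‖g t‖ := fun x ↦ (norm_integral_le_integral_norm _).trans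
    (setIntegral_le_integral hgi.norm (ae_of_all _ fun _ ↦ norm_nonneg _))
  have hGtop : Tendsto G atTop (𝓝 0) := tendsto_integral_Ioi_zero tendsto_id
  have hGbot : Tendsto G atBot (𝓝 (∫ t, g t)) :=
    (aecover_Ioi tendsto_id).integral_tendsto_of_countably_generated hgi
  have hWtop := hW0.mono_left atTop_le_cocompact
  have hWbot := hW0.mono_left atBot_le_cocompact
  have hfG : Integrable fun x ↦ f x * G x :=
    hfi.mul_bdd hGc.aestronglyMeasurable (ae_of_all _ hGb)
  have hfW : Integrable fun x ↦ f x * W x :=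
    hfi.mul_bdd hWc.aestronglyMeasurable (ae_of_all _ hC)
  have hgW : Integrable fun x ↦ g x * W x :=
    hgi.mul_bdd hWc.aestronglyMeasurable (ae_of_all _ hC)
  have hderiv : ∀ x, HasDerivAt (fun x ↦ W x * G x + G x ^ 2 / 2 + W x ^ 2 / 4)
      (-(f x * G x) - (g x * W x + f x * W x) / 2) x := fun x ↦ by
    refine ((((hW x).mul (hGd x)).add (((hGd x).pow 2).div_const 2)).add
      (((hW x).pow 2).div_const 4)).congr_deriv ?_
    simp
    ring
  have hftc := integral_of_hasDerivAt_of_tendsto hderiv (hfG.neg.sub ((hgW.add hfW).div_const 2))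
    (((hWbot.mul hGbot).add ((hGbot.pow 2).div_const 2)).add ((hWbot.pow 2).div_const 4))
    (((hWtop.mul hGtop).add ((hGtop.pow 2).div_const 2)).add ((hWtop.pow 2).div_const 4))
  have hsplit : ∫ x, (-(f x * G x) - (g x * W x + f x * W x) / 2)
      = -(∫ x, f x * G x) - ((∫ x, g x * W x) + ∫ x, f x * W x) / 2 := by
    rw [← integral_add hgW hfW, ← integral_neg, ← integral_div]
    exact integral_sub hfG.neg ((hgW.add hfW).div_const 2)
  rw [hsplit] at hftc
  linear_combination -hftc

section Fourier

/-- The function `q` is continuous and integrable, and the Fourier inversion formula holds for it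
with an integrable transform. -/
structure FourierInvertible (q : ℝ → ℂ) : Prop where
  continuous : Continuous q
  integrable : Integrable q
  integrable_ft : Integrable (ft q)
  eq_integral_ft : ∀ x : ℝ, q x = ∫ η : ℝ,
    ((Real.sqrt (2 * Real.pi) : ℝ) : ℂ)⁻¹ * ft q η * cexp (I * η * x)

theorem ft_eq_fourier (q : ℝ → ℂ) (ξ : ℝ) :
    ft q ξ = ((Real.sqrt (2 * Real.pi) : ℝ) : ℂ)⁻¹ * 𝓕 q ((2 * Real.pi)⁻¹ * ξ) := by
  have := ofReal_ne_zero.2 Real.pi_ne_zero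
  rw [ft, Real.fourier_real_eq_integral_exp_smul]
  congr 1
  refine integral_congr_ae (ae_of_all _ fun x ↦ ?_)
  simp only [smul_eq_mul]
  rw [mul_comm]
  congr 2
  push_cast
  field_simp

theorem sqrt_two_pi_sq : ((Real.sqrt (2 * Real.pi) : ℝ) : ℂ) ^ 2 = 2 * Real.pi := by
  rw [← ofReal_pow, Real.sq_sqrt (by positivity)]
  push_cast
  rfl

theorem sqrt_two_pi_ne_zero : ((Real.sqrt (2 * Real.pi) : ℝ) : ℂ) ≠ 0 :=
  ofReal_ne_zero.2 (Real.sqrt_pos.2 (by positivity)).ne'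

theorem SchwartzMap.fourierInvertible (q : SchwartzMap ℝ ℂ) : FourierInvertible q where
  continuous := q.continuous
  integrable := q.integrable
  integrable_ft := by
    rw [funext (ft_eq_fourier q), ← SchwartzMap.fourier_coe]
    exact ((𝓕 q).integrable.comp_mul_left' (inv_ne_zero Real.two_pi_pos.ne')).const_mul _
  eq_integral_ft x := by
    have hpi := ofReal_ne_zero.2 Real.pi_ne_zero
    have hinv : 𝓕⁻ (𝓕 (q : ℝ → ℂ)) x = q x := by
      rw [← SchwartzMap.fourier_coe, ← SchwartzMap.fourierInv_coe,
        FourierTransform.fourierInv_fourier_eq]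
    have hscale := Measure.integral_comp_mul_left
      (fun v : ℝ ↦ cexp (((2 * Real.pi * (v * x) : ℝ) : ℂ) * I) * 𝓕 (q : ℝ → ℂ) v)
      (2 * Real.pi)⁻¹
    rw [inv_inv, abs_of_pos Real.two_pi_pos] at hscale
    have hfactor : ∀ η : ℝ, ((Real.sqrt (2 * Real.pi) : ℝ) : ℂ)⁻¹ * ft q η * cexp (I * η * x)
        = (2 * Real.pi : ℂ)⁻¹ * (cexp (((2 * Real.pi * ((2 * Real.pi)⁻¹ * η * x) : ℝ) : ℂ) * I) *
          𝓕 (q : ℝ → ℂ) ((2 * Real.pi)⁻¹ * η)) := fun η ↦ by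
      rw [ft_eq_fourier, ← sqrt_two_pi_sq, mul_assoc _ η x,
        mul_inv_cancel_left₀ Real.two_pi_pos.ne', ofReal_mul]
      ring_nf
    simp only [hfactor]
    rw [integral_const_mul, hscale, ← hinv, Real.fourierInv_eq']
    simp only [smul_eq_mul, RCLike.inner_apply, conj_trivial, real_smul, ofReal_mul, ofReal_ofNat]
    rw [inv_mul_cancel_left₀ (mul_ne_zero two_ne_zero hpi)]
    exact integral_congr_ae (ae_of_all _ fun v ↦ by ring_nf)

theorem ft_conjReflect (q : ℝ → ℂ) (ξ : ℝ) : ft (conjReflect q) ξ = conj (ft q ξ) := by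
  rw [ft, ft, map_mul, map_inv₀, conj_ofReal, ← integral_conj,
    ← integral_neg_eq_self (fun x : ℝ ↦ conj (q x * cexp (-I * x * ξ)))]
  congr 1
  refine integral_congr_ae (ae_of_all _ fun x ↦ ?_)
  simp only [conjReflect, map_mul, ← exp_conj, map_neg, conj_I, conj_ofReal, neg_neg]
  push_cast
  ring_nf

theorem FourierInvertible.conjReflect {q : ℝ → ℂ} (hq : FourierInvertible q) :
    FourierInvertible (conjReflect q) where
  continuous := continuous_conj.comp (hq.continuous.comp continuous_neg)
  integrable := (conjLIE.integrable_comp_iff (μ := volume)).2 hq.integrable.comp_neg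
  integrable_ft := by
    rw [funext (ft_conjReflect q)]
    exact (conjLIE.integrable_comp_iff (μ := volume)).2 hq.integrable_ft
  eq_integral_ft x := by
    rw [_root_.conjReflect, hq.eq_integral_ft, ← integral_conj]
    refine integral_congr_ae (ae_of_all _ fun η ↦ ?_)
    simp only [ft_conjReflect, map_mul, map_inv₀, conj_ofReal, ← exp_conj, conj_I]
    push_cast
    ring_nf

/-- The product `q̂(η₁) q̂(η₂) conj(q̂(ξ₁)) conj(q̂(η₁ + η₂ - ξ₁))`, with `v = (ξ₁, η₁, η₂)`. -/
noncomputable def ftProd (q : ℝ → ℂ) (v : ℝ × ℝ × ℝ) : ℂ :=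
  ft q v.2.1 * ft q v.2.2 * conj (ft q v.1) * conj (ft q (v.2.1 + v.2.2 - v.1))

theorem ftProd_conjReflect (q : ℝ → ℂ) (v : ℝ × ℝ × ℝ) :
    ftProd (conjReflect q) v = conj (ftProd q v) := by
  simp [ftProd, ft_conjReflect]

theorem integral_mul_cexp_triple {r α β : ℝ → ℂ} (hr : Integrable r) (hα : Integrable α)
    (hβ : Integrable β) :
    Integrable (fun v : ℝ × ℝ × ℝ ↦ α v.1 * (β v.2.1 * β v.2.2) *
      ∫ x : ℝ, r x * cexp (I * (v.2.1 + v.2.2 - v.1 : ℝ) * x)) ∧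
    ∫ x : ℝ, r x * (∫ ξ : ℝ, α ξ * cexp (I * ξ * (-x : ℝ))) *
        (∫ η : ℝ, β η * cexp (I * η * x)) ^ 2
      = ∫ v : ℝ × ℝ × ℝ, α v.1 * (β v.2.1 * β v.2.2) *
          ∫ x : ℝ, r x * cexp (I * (v.2.1 + v.2.2 - v.1 : ℝ) * x) := by
  have hFint : Integrable (Function.uncurry fun (x : ℝ) (v : ℝ × ℝ × ℝ) ↦
      r x * (α v.1 * (β v.2.1 * β v.2.2)) * cexp (I * (v.2.1 + v.2.2 - v.1 : ℝ) * x)) :=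
    (hr.mul_prod (hα.mul_prod (hβ.mul_prod hβ))).mul_bdd (c := 1)
      (Continuous.aestronglyMeasurable (by fun_prop))
      (ae_of_all _ fun p ↦ (norm_cexp_I_mul_mul _ _).le)
  have hinner : ∀ v : ℝ × ℝ × ℝ,
      ∫ x : ℝ, r x * (α v.1 * (β v.2.1 * β v.2.2)) * cexp (I * (v.2.1 + v.2.2 - v.1 : ℝ) * x)
        = α v.1 * (β v.2.1 * β v.2.2) *
          ∫ x : ℝ, r x * cexp (I * (v.2.1 + v.2.2 - v.1 : ℝ) * x) := fun v ↦ by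
    rw [← integral_const_mul]
    exact integral_congr_ae (ae_of_all _ fun x ↦ by ring)
  refine ⟨hFint.integral_prod_right.congr (ae_of_all _ hinner), ?_⟩
  rw [← integral_congr_ae (ae_of_all _ hinner), ← integral_integral_swap hFint]
  refine integral_congr_ae (ae_of_all _ fun x ↦ ?_)
  simp only [sq]
  rw [← integral_prod_mul, mul_assoc (r x), ← integral_prod_mul, ← integral_const_mul]
  refine integral_congr_ae (ae_of_all _ fun v ↦ ?_)
  simp only
  rw [show I * ((v.2.1 + v.2.2 - v.1 : ℝ) : ℂ) * x
      = I * v.1 * (-x : ℝ) + (I * v.2.1 * x + I * v.2.2 * x) by push_cast; ring,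
    Complex.exp_add, Complex.exp_add]
  ring

theorem integral_conj_mul_tailInt_mul_sq {a : ℂ} (ha : 0 < a.im) {q : ℝ → ℂ}
    (hq : FourierInvertible q) :
    Integrable (fun v : ℝ × ℝ × ℝ ↦ ftProd q v / ((a + v.1) * (a + v.2.1) * (a + v.2.2))) ∧
    ∫ x, conj (q x) * tailInt a (conjReflect q) (-x) * tailInt a q x ^ 2
      = -(I / (2 * Real.pi)) * ∫ v : ℝ × ℝ × ℝ,
          ftProd q v / ((a + v.1) * (a + v.2.1) * (a + v.2.2)) := by
  set c : ℂ := ((Real.sqrt (2 * Real.pi) : ℝ) : ℂ) with hc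
  have hc0 : c ≠ 0 := sqrt_two_pi_ne_zero
  have hc2 : c ^ 2 = 2 * Real.pi := sqrt_two_pi_sq
  have hpi := ofReal_ne_zero.2 Real.pi_ne_zero
  have hβ := hq.integrable_ft.const_mul c⁻¹
  have hα := hq.conjReflect.integrable_ft.const_mul c⁻¹
  obtain ⟨hFint, heq⟩ := integral_mul_cexp_triple
    ((conjLIE.integrable_comp_iff (μ := volume)).2 hq.integrable)
    (integrable_mul_I_div_add ha hα) (integrable_mul_I_div_add ha hβ)
  have hr : ∀ ξ : ℝ, ∫ x : ℝ, conj (q x) * cexp (I * ξ * x) = c * conj (ft q ξ) := fun ξ ↦ by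
    rw [ft, map_mul, map_inv₀, conj_ofReal, ← hc, mul_inv_cancel_left₀ hc0, ← integral_conj]
    refine integral_congr_ae (ae_of_all _ fun x ↦ ?_)
    simp only [map_mul, ← exp_conj, map_neg, conj_I, conj_ofReal, neg_neg]
    ring_nf
  have hv : ∀ v : ℝ × ℝ × ℝ, c⁻¹ * ft (conjReflect q) v.1 * (I / (a + v.1)) *
      (c⁻¹ * ft q v.2.1 * (I / (a + v.2.1)) * (c⁻¹ * ft q v.2.2 * (I / (a + v.2.2)))) *
      ∫ x : ℝ, conj (q x) * cexp (I * (v.2.1 + v.2.2 - v.1 : ℝ) * x)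
      = -(I / (2 * Real.pi)) * (ftProd q v / ((a + v.1) * (a + v.2.1) * (a + v.2.2))) := by
    intro v
    have h1 := add_ofReal_ne_zero ha v.1
    have h2 := add_ofReal_ne_zero ha v.2.1
    have h3 := add_ofReal_ne_zero ha v.2.2
    rw [hr, ft_conjReflect, ftProd, ← hc2]
    field_simp
    rw [I_sq]
    ring
  constructor
  · have hne : -(I / (2 * Real.pi)) ≠ 0 := by simp [hpi]
    refine (integrable_const_mul_iff hne.isUnit _).1 ?_
    exact hFint.congr (ae_of_all _ hv)
  · rw [← integral_const_mul, ← integral_congr_ae (ae_of_all _ hv)]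
    refine Eq.trans ?_ heq
    refine integral_congr_ae (ae_of_all _ fun x ↦ ?_)
    simp only
    rw [tailInt_eq_integral ha hα hq.conjReflect.eq_integral_ft,
      tailInt_eq_integral ha hβ hq.eq_integral_ft]
    rfl

end Fourier

/-- For Schwartz `q` and `Im(λ²) > 0`, with `s₂(λ) = −λ²·I_λ({x₁<y₁})`,
`s₄(λ) = λ⁴·I_λ({x₁<y₁<x₂<y₂})` and `b₄(λ) = s₄(λ) − s₂(λ)²/2`, one has the Fourier
representation (with variables `v = (ξ₁, η₁, η₂)`)
`b₄(λ) = (i/(2π)) ∫_{ℝ³} λ⁴/((2λ²+ξ₁)(2λ²+η₁)(2λ²+η₂))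
          · Re(q̂(η₁)q̂(η₂)conj(q̂(ξ₁))conj(q̂(η₁+η₂−ξ₁))) dξ₁dη₁dη₂`. -/
theorem b4_fourier (q : SchwartzMap ℝ ℂ) (lam : ℂ) (hlam : 0 < (lam ^ 2).im) :
    lam ^ 4 * (∫ p in R_XYXY, f4 ⇑q lam p)
      - (-lam ^ 2 * ∫ p in R_XY, f2 ⇑q lam p) ^ 2 / 2
      = Complex.I / (2 * (Real.pi : ℂ)) *
          ∫ v : ℝ × ℝ × ℝ,
            lam ^ 4 /
                ((2 * lam ^ 2 + (v.1 : ℂ)) * (2 * lam ^ 2 + (v.2.1 : ℂ))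
                  * (2 * lam ^ 2 + (v.2.2 : ℂ))) *
              (((ft ⇑q v.2.1 * ft ⇑q v.2.2 * (starRingEnd ℂ) (ft ⇑q v.1)
                  * (starRingEnd ℂ) (ft ⇑q (v.2.1 + v.2.2 - v.1))).re : ℝ) : ℂ) := by
  have ha : 0 < (2 * lam ^ 2).im := by
    rw [← ofReal_ofNat, im_ofReal_mul]
    linarith
  have hq := q.fourierInvertible
  have hhβ := hq.integrable_ft.const_mul ((Real.sqrt (2 * Real.pi) : ℝ) : ℂ)⁻¹
  have hhα := hq.conjReflect.integrable_ft.const_mul ((Real.sqrt (2 * Real.pi) : ℝ) : ℂ)⁻¹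
  set p : ℝ → ℂ := conjReflect q with hp
  set A : ℝ → ℂ := fun x ↦ tailInt (2 * lam ^ 2) p (-x) with hA
  set B : ℝ → ℂ := tailInt (2 * lam ^ 2) q with hB
  have hBd : ∀ x, HasDerivAt B (-q x - I * (2 * lam ^ 2) * B x) x :=
    hasDerivAt_tailInt ha hhβ hq.eq_integral_ft
  have hAd : ∀ x, HasDerivAt A (conj (q x) + I * (2 * lam ^ 2) * A x) x := fun x ↦ by
    refine ((hasDerivAt_tailInt ha hhα hq.conjReflect.eq_integral_ft
      (-x)).scomp x (hasDerivAt_neg x)).congr_deriv ?_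
    simp only [conjReflect, neg_neg, neg_smul, one_smul, hA, hp]
    ring
  have hAc : Continuous A := continuous_iff_continuousAt.2 fun x ↦ (hAd x).continuousAt
  have hBc : Continuous B := continuous_iff_continuousAt.2 fun x ↦ (hBd x).continuousAt
  obtain ⟨CB, hCB⟩ := exists_norm_tailInt_le ha hhβ hq.eq_integral_ft
  obtain ⟨CA, hCA⟩ := exists_norm_tailInt_le ha hhα hq.conjReflect.eq_integral_ft
  have hqconj : Integrable fun x ↦ conj (q x) :=
    (conjLIE.integrable_comp_iff (μ := volume)).2 hq.integrable
  have hg : Integrable fun x ↦ conj (q x) * B x :=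
    hqconj.mul_bdd hBc.aestronglyMeasurable (ae_of_all _ hCB)
  have hf : Integrable fun x ↦ q x * A x :=
    hq.integrable.mul_bdd hAc.aestronglyMeasurable (ae_of_all _ fun x ↦ hCA (-x))
  have hgc : Continuous fun x ↦ conj (q x) * B x :=
    (continuous_conj.comp hq.continuous).mul hBc
  have hB0 : Tendsto B (cocompact ℝ) (𝓝 0) :=
    tendsto_tailInt_cocompact ha hhβ hq.eq_integral_ft
  have hA0 : Tendsto A (cocompact ℝ) (𝓝 0) :=
    (tendsto_tailInt_cocompact ha hhα hq.conjReflect.eq_integral_ft).comp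
      (Homeomorph.neg ℝ).isClosedEmbedding.tendsto_cocompact
  have htail := integral_mul_tail_sub_sq (W := fun x ↦ A x * B x) hgc hf hg
    (fun x ↦ ((hAd x).mul (hBd x)).congr_deriv (by ring))
    (by simpa using hA0.mul hB0) (C := CA * CB)
    (fun x ↦ (norm_mul_le _ _).trans
      (mul_le_mul (hCA _) (hCB _) (norm_nonneg _) ((norm_nonneg _).trans (hCA 0))))
  have hs₄ : ∫ p in R_XYXY, f4 q lam p = ∫ x, q x * A x * ∫ t in Ioi x, conj (q t) * B t := by
    rw [setIntegral_R_XYXY hlam hq.continuous hq.integrable]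
    exact setIntegral_R_XY_ker_mul hlam hq.continuous hq.integrable
      (continuous_iff_continuousAt.2 fun x ↦ (hasDerivAt_integral_Ioi hgc hg x).continuousAt)
      (fun x ↦ (norm_integral_le_integral_norm _).trans
        (setIntegral_le_integral hg.norm (ae_of_all _ fun _ ↦ norm_nonneg _)))
  obtain ⟨hi₁, he₁⟩ := integral_conj_mul_tailInt_mul_sq ha hq
  obtain ⟨hi₂, he₂⟩ := integral_conj_mul_tailInt_mul_sq ha hq.conjReflect
  have hgW : ∫ x, conj (q x) * B x * (A x * B x) = ∫ x, conj (q x) * A x * B x ^ 2 :=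
    integral_congr_ae (ae_of_all _ fun x ↦ by ring)
  have hfW : ∫ x, q x * A x * (A x * B x)
      = ∫ x, conj (p x) * tailInt (2 * lam ^ 2) (conjReflect p) (-x) *
          tailInt (2 * lam ^ 2) p x ^ 2 := by
    rw [← integral_neg_eq_self, hp, conjReflect_conjReflect]
    refine integral_congr_ae (ae_of_all _ fun x ↦ ?_)
    simp only [conjReflect, conj_conj, hA, hB, neg_neg]
    ring
  have hre : ∀ v : ℝ × ℝ × ℝ,
      lam ^ 4 / ((2 * lam ^ 2 + v.1) * (2 * lam ^ 2 + v.2.1) * (2 * lam ^ 2 + v.2.2)) *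
        ((ftProd q v).re : ℂ)
      = lam ^ 4 / 2 * (
        ftProd q v / ((2 * lam ^ 2 + v.1) * (2 * lam ^ 2 + v.2.1) * (2 * lam ^ 2 + v.2.2)) +
        ftProd p v / ((2 * lam ^ 2 + v.1) * (2 * lam ^ 2 + v.2.1) * (2 * lam ^ 2 + v.2.2))) :=
    fun v ↦ by
      rw [hp, ftProd_conjReflect, ← add_div, add_conj]
      push_cast
      ring
  have hrhs := integral_congr_ae (μ := volume) (ae_of_all _ hre)
  rw [integral_const_mul, integral_add hi₁ hi₂] at hrhs
  rw [hgW, hfW, he₁, he₂] at htail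
  rw [setIntegral_R_XY_ker hlam hq.continuous hq.integrable, hs₄]
  refine Eq.trans ?_ (congrArg (I / (2 * (Real.pi : ℂ)) * ·) hrhs.symm)
  linear_combination lam ^ 4 * htail
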